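/- Let G be an ADMG containing, on an ordered triple of vertices (v_1, v_2, v_3), the labeled subgraph with edges v_1→v_2, v_2→v_3, v_2↔v_3, and v_1→v_3. Then the edge v_1→v_3 is underdetermined in G: the graph G' obtained from G by deleting the edge v_1→v_3 is an ADMG that is Markov equivalent to G. -/

import Mathlib

namespace CausalMEC

/-- A directed graph on `Fin n`, given by a Boolean edge function (`d a b = true` means `a → b`). -/
abbrev Dir (n : ℕ) := Fin n → Fin n → Bool

/-- Directed reachability (zero or more steps). -/
def Reach {n : ℕ} (d : Dir n) : Fin n → Fin n → Prop :=
  Relation.ReflTransGen fun a b => d a b = true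

/-- No directed cycles (including no self-loops). -/
def Acyclic {n : ℕ} (d : Dir n) : Prop :=
  ∀ v, ¬ Relation.TransGen (fun a b => d a b = true) v v

/-- A directed acyclic graph. -/
def IsDAG {n : ℕ} (d : Dir n) : Prop :=
  (∀ v, d v v = false) ∧ Acyclic d

/-- A directed (possibly cyclic) graph with edges between distinct vertices. -/
def IsDCG {n : ℕ} (d : Dir n) : Prop :=
  ∀ v, d v v = false

/-- The number of directed edges. -/
def edgeCount {n : ℕ} (d : Dir n) : ℕ :=
  (Finset.univ.filter fun q : Fin n × Fin n => d q.1 q.2 = true).card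

/-- The parent set of a vertex. -/
def parents {n : ℕ} (d : Dir n) (v : Fin n) : Finset (Fin n) :=
  Finset.univ.filter fun u => d u v = true

/-! ### Paths, d-connection and Markov equivalence in mixed graphs
A mixed graph is given by a directed part `d` and a bidirected part `b`. -/

/-- The kind of a step on a path: a directed edge traversed forwards, a directed edge
traversed backwards, or a bidirected edge. -/
inductive EdgeKind : Type
  | fwd | bwd | bidir
deriving DecidableEq

/-- Does the step point into its second endpoint? -/
def EdgeKind.intoSnd : EdgeKind → Bool
  | .fwd => true
  | .bwd => false
  | .bidir => true

/-- Does the step point into its first endpoint? -/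
def EdgeKind.intoFst : EdgeKind → Bool
  | .fwd => false
  | .bwd => true
  | .bidir => true

/-- A (possibly self-intersecting) path from `u` to `v` in the mixed graph `(d, b)`. -/
structure MPath {n : ℕ} (d b : Dir n) (u v : Fin n) where
  len : ℕ
  vert : Fin (len + 1) → Fin n
  kind : Fin len → EdgeKind
  first_eq : vert 0 = u
  last_eq : vert (Fin.last len) = v
  valid : ∀ i : Fin len,
    (kind i = .fwd → d (vert i.castSucc) (vert i.succ) = true) ∧
    (kind i = .bwd → d (vert i.succ) (vert i.castSucc) = true) ∧
    (kind i = .bidir → b (vert i.castSucc) (vert i.succ) = true)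

/-- Whether the internal vertex at position `i` of a path is a collider. -/
def MPath.colliderAt {n : ℕ} {d b : Dir n} {u v : Fin n} (π : MPath d b u v)
    (i : ℕ) (h1 : 0 < i) (h2 : i < π.len) : Bool :=
  (π.kind ⟨i - 1, by omega⟩).intoSnd && (π.kind ⟨i, h2⟩).intoFst

/-- A path is active given a conditioning set `Z` if every non-collider on it avoids `Z`
and every collider on it is in `Z` or has a descendant in `Z`. -/
def MPath.Active {n : ℕ} {d b : Dir n} {u v : Fin n} (π : MPath d b u v)
    (Z : Finset (Fin n)) : Prop :=
  ∀ (i : ℕ) (h1 : 0 < i) (h2 : i < π.len),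
    (π.colliderAt i h1 h2 = true →
      ∃ x ∈ Z, Reach d (π.vert ⟨i, by omega⟩) x) ∧
    (π.colliderAt i h1 h2 = false →
      π.vert ⟨i, by omega⟩ ∉ Z)

/-- d-connection given a conditioning set. -/
def DConn {n : ℕ} (d b : Dir n) (u v : Fin n) (Z : Finset (Fin n)) : Prop :=
  ∃ π : MPath d b u v, π.Active Z

/-- Markov equivalence of two mixed graphs: the same d-connection relations. -/
def MarkovEquiv {n : ℕ} (d b d' b' : Dir n) : Prop :=
  ∀ (u v : Fin n) (Z : Finset (Fin n)), u ≠ v → u ∉ Z → v ∉ Z →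
    (DConn d b u v Z ↔ DConn d' b' u v Z)

/-- The empty bidirected part: a purely directed graph. -/
def noBi (n : ℕ) : Dir n := fun _ _ => false

/-- Markov equivalence for purely directed graphs. -/
def MarkovEquivD {n : ℕ} (d d' : Dir n) : Prop :=
  MarkovEquiv d (noBi n) d' (noBi n)

/-- The Markov equivalence class of a DAG (within DAGs). -/
def MECdag {n : ℕ} (d : Dir n) : Set (Dir n) :=
  {d' | IsDAG d' ∧ MarkovEquivD d d'}

/-- An acyclic directed mixed graph. -/
def IsADMG {n : ℕ} (d b : Dir n) : Prop :=
  IsDAG d ∧ (∀ v w, b v w = b w v) ∧ (∀ v, b v v = false)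

/-- The Markov equivalence class of an ADMG (within ADMGs). -/
def MECadmg {n : ℕ} (d b : Dir n) : Set (Dir n × Dir n) :=
  {G | IsADMG G.1 G.2 ∧ MarkovEquiv d b G.1 G.2}

/-- The Markov equivalence class of a DCG (within DCGs). -/
def MECdcg {n : ℕ} (d : Dir n) : Set (Dir n) :=
  {d' | IsDCG d' ∧ MarkovEquivD d d'}

/-! ### The distribution `D(n,p)` and uniform ADMGs/DCGs -/

/-- The (unnormalized) weight of a DAG under `D(n,p)`. -/
noncomputable def dagWeight {n : ℕ} (p : ℝ) (d : Dir n) : ℝ :=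
  (p / (1 - p)) ^ edgeCount d

open scoped Classical in
/-- Probability of the event `A` under `D(n,p)`. -/
noncomputable def prD (n : ℕ) (p : ℝ) (A : Dir n → Prop) : ℝ :=
  (∑ d : Dir n, if IsDAG d ∧ A d then dagWeight p d else 0) /
    (∑ d : Dir n, if IsDAG d then dagWeight p d else 0)

open scoped Classical in
/-- Expectation of `f` under `D(n,p)`. -/
noncomputable def expD (n : ℕ) (p : ℝ) (f : Dir n → ℝ) : ℝ :=
  (∑ d : Dir n, if IsDAG d then f d * dagWeight p d else 0) /
    (∑ d : Dir n, if IsDAG d then dagWeight p d else 0)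

/-- Conditional probability of `A` given `B` under `D(n,p)`. -/
noncomputable def condPrD (n : ℕ) (p : ℝ) (A B : Dir n → Prop) : ℝ :=
  prD n p (fun d => A d ∧ B d) / prD n p B

open scoped Classical in
/-- Expectation of `f` under the uniform distribution on ADMGs on `n` vertices. -/
noncomputable def expADMG (n : ℕ) (f : Dir n × Dir n → ℝ) : ℝ :=
  (∑ G : Dir n × Dir n, if IsADMG G.1 G.2 then f G else 0) /
    (∑ G : Dir n × Dir n, if IsADMG G.1 G.2 then (1 : ℝ) else 0)

open scoped Classical in
/-- Expectation of `f` under the uniform distribution on DCGs on `n` vertices. -/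
noncomputable def expDCG (n : ℕ) (f : Dir n → ℝ) : ℝ :=
  (∑ d : Dir n, if IsDCG d then f d else 0) /
    (∑ d : Dir n, if IsDCG d then (1 : ℝ) else 0)

open scoped Classical in
/-- Probability of the event `A` under the uniform distribution on DCGs on `n` vertices. -/
noncomputable def prDCG (n : ℕ) (A : Dir n → Prop) : ℝ :=
  (∑ d : Dir n, if IsDCG d ∧ A d then (1 : ℝ) else 0) /
    (∑ d : Dir n, if IsDCG d then (1 : ℝ) else 0)

/-! ### Tower decomposition -/

/-- The sources of `d` within a vertex set `S` (no parents inside `S`). -/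
def sourcesIn {n : ℕ} (d : Dir n) (S : Finset (Fin n)) : Finset (Fin n) :=
  S.filter fun v => ∀ u ∈ S, d u v = false

/-- The vertices remaining after peeling off `k` layers of sources. -/
def remaining {n : ℕ} (d : Dir n) : ℕ → Finset (Fin n)
  | 0 => Finset.univ
  | k + 1 => remaining d k \ sourcesIn d (remaining d k)

/-- The `i`-th layer (1-based) of the tower decomposition of `d`. -/
def towerLayer {n : ℕ} (d : Dir n) (i : ℕ) : Finset (Fin n) :=
  sourcesIn d (remaining d (i - 1))

/-- The 1-based index of the layer containing `v`. -/
def layerIdx {n : ℕ} (d : Dir n) (v : Fin n) : ℕ :=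
  ((Finset.range n).filter fun j => v ∈ remaining d j).card

/-- The tower of a DAG: only the edges between adjacent layers are kept. -/
def tower {n : ℕ} (d : Dir n) : Dir n :=
  fun a c => d a c && decide (layerIdx d c = layerIdx d a + 1)

/-- `h` is the tower vector of `d` (layer sizes, 1-based, and no further layers). -/
def hasTowerVector {n : ℕ} (d : Dir n) (h : List ℕ) : Prop :=
  (∀ i : Fin h.length, (towerLayer d (i.val + 1)).card = h.get i) ∧
    towerLayer d (h.length + 1) = ∅

/-- `H` is the tower decomposition of `d`. -/
def hasTowerDecomp {n : ℕ} (d : Dir n) (H : List (Finset (Fin n))) : Prop :=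
  (∀ i : Fin H.length, towerLayer d (i.val + 1) = H.get i) ∧
    towerLayer d (H.length + 1) = ∅

/-- The weight `w(h)` of a tower vector `h = (h_1, …, h_s)`. -/
noncomputable def towerWeight (p : ℝ) (h : List ℕ) : ℝ :=
  (Nat.multinomial Finset.univ (fun i : Fin h.length => h.get i) : ℝ) *
    ∏ k ∈ Finset.Icc 2 h.length,
      (1 - (1 - p) ^ h.getD (k - 2) 0) ^ h.getD (k - 1) 0 /
        (1 - p) ^ (h.getD (k - 1) 0 * ∑ i ∈ Finset.range (k - 1), h.getD i 0)

/-! ### Edge reversal and deletion -/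

/-- Reverse the edge `v → w`. -/
def reverseEdge {n : ℕ} (d : Dir n) (v w : Fin n) : Dir n :=
  fun a c => if a = v ∧ c = w then false else if a = w ∧ c = v then true else d a c

/-- Delete the edge `v → w`. -/
def deleteEdge {n : ℕ} (d : Dir n) (v w : Fin n) : Dir n :=
  fun a c => if a = v ∧ c = w then false else d a c

/-- The edge `v → w` of a DAG is reversible: reversing it yields a Markov-equivalent DAG. -/
def Reversible {n : ℕ} (d : Dir n) (v w : Fin n) : Prop :=
  d v w = true ∧ IsDAG (reverseEdge d v w) ∧ MarkovEquivD d (reverseEdge d v w)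

/-- `d` has a matching of reversible layer-2-edges of size at least `m`. -/
def hasRevL2Matching {n : ℕ} (d : Dir n) (m : ℝ) : Prop :=
  ∃ S : Finset (Fin n × Fin n),
    (∀ e ∈ S, Reversible d e.1 e.2 ∧ e.2 ∈ towerLayer d 2) ∧
    (∀ e ∈ S, ∀ e' ∈ S, e ≠ e' →
      e.1 ≠ e'.1 ∧ e.1 ≠ e'.2 ∧ e.2 ≠ e'.1 ∧ e.2 ≠ e'.2) ∧
    m ≤ (S.card : ℝ)

/-! ### Cycles and the `Reverse` construction -/

/-- Cyclic successor in `Fin k`. -/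
def cycSucc {k : ℕ} (i : Fin k) : Fin k :=
  ⟨(i.val + 1) % k, Nat.mod_lt _ i.pos⟩

/-- The reversed parametrization of a cycle. -/
def cycRev {n k : ℕ} (c : Fin k → Fin n) : Fin k → Fin n :=
  fun i => c ⟨(k - i.val) % k, Nat.mod_lt _ i.pos⟩

/-- `c` lists the (distinct) vertices of a directed cycle of `d`, in order. -/
def IsCycle {n k : ℕ} (d : Dir n) (c : Fin k → Fin n) : Prop :=
  Function.Injective c ∧ ∀ i, d (c i) (c (cycSucc i)) = true

/-- The `Reverse(G, C)` construction: reverse the cycle `c` and redirect every edge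
`w → v_i` with `w ∈ Pa(v_i) \ {v_{i-1}}` to `w → v_{i-1}`. -/
def reverseCycle {n k : ℕ} (d : Dir n) (c : Fin k → Fin n) : Dir n :=
  fun a e =>
    decide ((∃ j : Fin k, e = c j ∧
        (a = c (cycSucc j) ∨ (d a (c (cycSucc j)) = true ∧ a ≠ c j))) ∨
      ((∀ j : Fin k, e ≠ c j) ∧ d a e = true))

/-- A vertex triple induces exactly a directed 3-cycle. -/
def induces3Cycle {n : ℕ} (d : Dir n) (W : Finset (Fin n)) : Prop :=
  ∃ a b c : Fin n, W = {a, b, c} ∧ a ≠ b ∧ a ≠ c ∧ b ≠ c ∧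
    d a b = true ∧ d b c = true ∧ d c a = true ∧
    d b a = false ∧ d c b = false ∧ d a c = false

/-- The relation that a single step of kind `k` requires between its endpoints. -/
def EdgeKind.Step {n : ℕ} (d b : Dir n) (k : EdgeKind) (x y : Fin n) : Prop :=
  (k = .fwd → d x y = true) ∧ (k = .bwd → d y x = true) ∧ (k = .bidir → b x y = true)

/-- The condition for an internal vertex `x`, which is a collider iff `c = true`, not to block a
path given `Z`. -/
def Unblocked {n : ℕ} (d : Dir n) (Z : Finset (Fin n)) (c : Bool) (x : Fin n) : Prop :=
  (c = true → ∃ z ∈ Z, Reach d x z) ∧ (c = false → x ∉ Z)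

/-- Nonempty active paths, built edge by edge; the Boolean index records whether the last step
points into the final vertex. -/
inductive ActiveWalk {n : ℕ} (d b : Dir n) (Z : Finset (Fin n)) (u : Fin n) :
    Fin n → Bool → Prop
  | single {v : Fin n} (k : EdgeKind) (h : k.Step d b u v) : ActiveWalk d b Z u v k.intoSnd
  | snoc {v w : Fin n} {s : Bool} (k : EdgeKind) (p : ActiveWalk d b Z u v s)
      (h : k.Step d b v w) (hv : Unblocked d Z (s && k.intoFst) v) :
      ActiveWalk d b Z u w k.intoSnd

theorem MPath.activeWalk {n : ℕ} {d b : Dir n} {u v : Fin n} {Z : Finset (Fin n)}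
    (π : MPath d b u v) (hπ : π.Active Z) (i : ℕ) (hi : i < π.len) :
    ActiveWalk d b Z u (π.vert ⟨i + 1, by omega⟩) (π.kind ⟨i, hi⟩).intoSnd := by
  induction i with
  | zero =>
    have h : (π.kind ⟨0, hi⟩).Step d b (π.vert 0) (π.vert ⟨0 + 1, by omega⟩) := π.valid ⟨0, hi⟩
    rw [π.first_eq] at h
    exact .single _ h
  | succ i ih =>
    exact .snoc _ (ih (by omega)) (π.valid ⟨i + 1, hi⟩) (hπ (i + 1) (by omega) hi)

theorem ActiveWalk.exists_sequence {n : ℕ} {d b : Dir n} {Z : Finset (Fin n)} {u v : Fin n}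
    {s : Bool} (p : ActiveWalk d b Z u v s) :
    ∃ (m : ℕ) (f : ℕ → Fin n) (g : ℕ → EdgeKind), f 0 = u ∧ f (m + 1) = v ∧
      (g m).intoSnd = s ∧ (∀ i ≤ m, (g i).Step d b (f i) (f (i + 1))) ∧
      ∀ i < m, Unblocked d Z ((g i).intoSnd && (g (i + 1)).intoFst) (f (i + 1)) := by
  induction p with
  | @single v k h =>
    refine ⟨0, fun i => if i = 0 then u else v, fun _ => k, by simp, by simp, rfl, ?_, by simp⟩
    intro i hi
    obtain rfl : i = 0 := by omega
    simpa using h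
  | @snoc v w s k p h hv ih =>
    obtain ⟨m, f, g, h0, h1, h2, h3, h4⟩ := ih
    refine ⟨m + 1, fun i => if i ≤ m + 1 then f i else w, fun i => if i ≤ m then g i else k,
      by simp [h0], by simp, by simp, ?_, ?_⟩
    · intro i hi
      rcases Nat.lt_or_ge m i with hm | hm
      · obtain rfl : i = m + 1 := by omega
        simpa [h1] using h
      · simpa [hm, Nat.le_succ_of_le hm] using h3 i hm
    · intro i hi
      rcases Nat.lt_or_ge i m with hm | hm
      · simpa [hm.le, Nat.succ_le_of_lt hm] using h4 i hm
      · obtain rfl : i = m := by omega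
        simpa [h1, h2] using hv

theorem ActiveWalk.dConn {n : ℕ} {d b : Dir n} {Z : Finset (Fin n)} {u v : Fin n}
    {s : Bool} (p : ActiveWalk d b Z u v s) : DConn d b u v Z := by
  obtain ⟨m, f, g, h0, h1, -, h3, h4⟩ := p.exists_sequence
  refine ⟨⟨m + 1, fun i => f i, fun i => g i, h0, h1, fun i => h3 i (by omega)⟩, ?_⟩
  rintro (_ | i) hi hi'
  · omega
  · exact h4 i (Nat.lt_of_succ_lt_succ hi')

theorem DConn.exists_activeWalk {n : ℕ} {d b : Dir n} {Z : Finset (Fin n)} {u v : Fin n}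
    (h : DConn d b u v Z) (huv : u ≠ v) : ∃ s, ActiveWalk d b Z u v s := by
  obtain ⟨π, hπ⟩ := h
  have hlen : π.len ≠ 0 := by
    intro h0
    apply huv
    have h : (0 : Fin (π.len + 1)) = Fin.last π.len := Fin.ext h0.symm
    exact π.first_eq.symm.trans ((congrArg π.vert h).trans π.last_eq)
  have hlast : (⟨π.len - 1 + 1, by omega⟩ : Fin (π.len + 1)) = Fin.last π.len :=
    Fin.ext (by simp; omega)
  have hw := π.activeWalk hπ (π.len - 1) (by omega)
  rw [hlast, π.last_eq] at hw
  exact ⟨_, hw⟩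

theorem Reach.mono {n : ℕ} {d d' : Dir n} (hd : ∀ x y, d x y = true → Reach d' x y)
    {x y : Fin n} (h : Reach d x y) : Reach d' x y := by
  induction h with
  | refl => exact .refl
  | tail _ hyz ih => exact ih.trans (hd _ _ hyz)

theorem Unblocked.mono {n : ℕ} {d d' : Dir n} (hd : ∀ x y, d x y = true → Reach d' x y)
    {Z : Finset (Fin n)} {c : Bool} {x : Fin n} (h : Unblocked d Z c x) :
    Unblocked d' Z c x :=
  ⟨fun hc => let ⟨z, hz, hr⟩ := h.1 hc; ⟨z, hz, hr.mono hd⟩, h.2⟩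

theorem ActiveWalk.mono {n : ℕ} {d d' b : Dir n} (hd : ∀ x y, d x y = true → d' x y = true)
    {Z : Finset (Fin n)} {u v : Fin n} {s : Bool} (p : ActiveWalk d b Z u v s) :
    ActiveWalk d' b Z u v s := by
  have hstep {k : EdgeKind} {x y : Fin n} (h : k.Step d b x y) : k.Step d' b x y :=
    ⟨fun hk => hd _ _ (h.1 hk), fun hk => hd _ _ (h.2.1 hk), h.2.2⟩
  induction p with
  | single k h => exact .single k (hstep h)
  | snoc k p h hv ih =>
    exact .snoc k ih (hstep h) (hv.mono fun x y hxy => .single (hd x y hxy))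

theorem deleteEdge_of_ne {n : ℕ} {d : Dir n} {v w x y : Fin n} (h : ¬ (x = v ∧ y = w)) :
    deleteEdge d v w x y = d x y :=
  if_neg h

theorem deleteEdge_le {n : ℕ} {d : Dir n} {v w x y : Fin n}
    (h : deleteEdge d v w x y = true) : d x y = true := by
  unfold deleteEdge at h
  split_ifs at h
  exact h

theorem IsADMG.deleteEdge {n : ℕ} {d b : Dir n} (hG : IsADMG d b) (v w : Fin n) :
    IsADMG (deleteEdge d v w) b := by
  refine ⟨⟨fun x => ?_, fun x hx =>
    hG.1.2 x (Relation.TransGen.mono (fun _ _ => deleteEdge_le) x x hx)⟩, hG.2⟩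
  rw [Bool.eq_false_iff]
  intro hx
  simpa [hG.1.1 x] using deleteEdge_le hx

theorem EdgeKind.Step.deleteEdge {n : ℕ} {d b : Dir n} {k : EdgeKind} {v w x y : Fin n}
    (h : k.Step d b x y) (hf : ¬ (k = .fwd ∧ x = v ∧ y = w))
    (hb : ¬ (k = .bwd ∧ y = v ∧ x = w)) : k.Step (deleteEdge d v w) b x y := by
  refine ⟨fun hk => ?_, fun hk => ?_, h.2.2⟩
  · rw [deleteEdge_of_ne fun hxy => hf ⟨hk, hxy⟩]
    exact h.1 hk
  · rw [deleteEdge_of_ne fun hxy => hb ⟨hk, hxy⟩]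
    exact h.2.1 hk

/-- Active paths can be transported along a change of the directed part if every step can be
replaced by one step, or by two steps through an unblocked vertex, with the same end marks. -/
theorem ActiveWalk.of_detour {n : ℕ} {d d' b : Dir n} {Z : Finset (Fin n)}
    (hd : ∀ x y, d x y = true → Reach d' x y)
    (hstep : ∀ (k : EdgeKind) (x y : Fin n), k.Step d b x y → k.Step d' b x y ∨
      ∃ (k₁ k₂ : EdgeKind) (m : Fin n), k₁.Step d' b x m ∧ k₂.Step d' b m y ∧
        k₁.intoFst = k.intoFst ∧ k₂.intoSnd = k.intoSnd ∧
        Unblocked d' Z (k₁.intoSnd && k₂.intoFst) m)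
    {u v : Fin n} {s : Bool} (p : ActiveWalk d b Z u v s) : ActiveWalk d' b Z u v s := by
  induction p with
  | single k h =>
    rcases hstep k _ _ h with h | ⟨k₁, k₂, m, h₁, h₂, -, hs, hm⟩
    · exact .single k h
    · rw [← hs]
      exact .snoc k₂ (.single k₁ h₁) h₂ hm
  | snoc k p h hv ih =>
    rcases hstep k _ _ h with h | ⟨k₁, k₂, m, h₁, h₂, hf, hs, hm⟩
    · exact .snoc k ih h (hv.mono hd)
    · rw [← hs]
      exact .snoc k₂ (.snoc k₁ ih h₁ (hf ▸ hv.mono hd)) h₂ hm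

theorem EdgeKind.Step.detour {n : ℕ} {d b : Dir n} {Z : Finset (Fin n)}
    (hb : ∀ v w, b v w = b w v) {v₁ v₂ v₃ : Fin n} (h12 : d v₁ v₂ = true)
    (h23 : d v₂ v₃ = true) (hb23 : b v₂ v₃ = true) {k : EdgeKind}
    {x y : Fin n}
    (hxy : k = .fwd ∧ x = v₁ ∧ y = v₃ ∨ k = .bwd ∧ y = v₁ ∧ x = v₃) :
    ∃ (k₁ k₂ : EdgeKind) (m : Fin n), k₁.Step d b x m ∧ k₂.Step d b m y ∧
      k₁.intoFst = k.intoFst ∧ k₂.intoSnd = k.intoSnd ∧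
      Unblocked d Z (k₁.intoSnd && k₂.intoFst) m := by
  have hb32 : b v₃ v₂ = true := hb v₂ v₃ ▸ hb23
  have hZ (h : v₂ ∈ Z) : ∃ z ∈ Z, Reach d v₂ z := ⟨v₂, h, .refl⟩
  rcases hxy with ⟨rfl, rfl, rfl⟩ | ⟨rfl, rfl, rfl⟩ <;> by_cases h2 : v₂ ∈ Z
  · exact ⟨.fwd, .bidir, v₂, by simp_all [EdgeKind.Step, Unblocked, intoFst, intoSnd]⟩
  · exact ⟨.fwd, .fwd, v₂, by simp_all [EdgeKind.Step, Unblocked, intoFst, intoSnd]⟩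
  · exact ⟨.bidir, .bwd, v₂, by simp_all [EdgeKind.Step, Unblocked, intoFst, intoSnd]⟩
  · exact ⟨.bwd, .bwd, v₂, by simp_all [EdgeKind.Step, Unblocked, intoFst, intoSnd]⟩

/-- Lemma 4.2: in any ADMG containing the labeled subgraph `S̄`
(edges `v₁ → v₂`, `v₂ → v₃`, `v₂ ↔ v₃`, `v₁ → v₃`), the edge `v₁ → v₃` is
underdetermined: deleting it yields a Markov-equivalent ADMG. -/
theorem admg_underdetermined_edge (n : ℕ) (d b : Dir n) (hG : IsADMG d b)
    (v₁ v₂ v₃ : Fin n)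
    (h12 : d v₁ v₂ = true) (h23 : d v₂ v₃ = true) (hb23 : b v₂ v₃ = true)
    (h13 : d v₁ v₃ = true) :
    IsADMG (deleteEdge d v₁ v₃) b ∧ MarkovEquiv d b (deleteEdge d v₁ v₃) b := by
  refine ⟨hG.deleteEdge v₁ v₃, fun u v Z huv _ _ => ⟨fun h => ?_, fun h => ?_⟩⟩
  · have h12' : deleteEdge d v₁ v₃ v₁ v₂ = true := by
      rwa [deleteEdge_of_ne]
      rintro ⟨-, rfl⟩
      simp [hG.1.1] at h23
    have h23' : deleteEdge d v₁ v₃ v₂ v₃ = true := by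
      rwa [deleteEdge_of_ne]
      rintro ⟨rfl, -⟩
      simp [hG.1.1] at h12
    obtain ⟨s, p⟩ := h.exists_activeWalk huv
    refine (p.of_detour (fun x y hxy => ?_) fun k x y hk => ?_).dConn
    · by_cases hdel : x = v₁ ∧ y = v₃
      · obtain ⟨rfl, rfl⟩ := hdel
        exact .tail (.single h12') h23'
      · exact .single (by rwa [deleteEdge_of_ne hdel])
    · by_cases hdel : k = .fwd ∧ x = v₁ ∧ y = v₃ ∨ k = .bwd ∧ y = v₁ ∧ x = v₃
      · exact .inr (EdgeKind.Step.detour hG.2.1 h12' h23' hb23 hdel)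
      · exact .inl (hk.deleteEdge (fun h => hdel (.inl h)) fun h => hdel (.inr h))
  · obtain ⟨s, p⟩ := h.exists_activeWalk huv
    exact (p.mono fun _ _ => deleteEdge_le).dConn

end CausalMEC
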